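/- arXiv:2205.07972 — 6 statements merged into one kernel-verified Lean document; each statement's English description precedes it below -/
import Mathlib

section
/- Proposition 1 (optimality of the explicit solution, non-degenerate case): Suppose μ* > 0 satisfies Σ_{i=1}^d (min{γ_i, (v_i/(p·μ*))^{1/(p−1)}})^p = ε^p. Define δ* ∈ ℝ^d by δ*_i = min{γ_i, (v_i/(p·μ*))^{1/(p−1)}} · sign(w_i) for each i. Then δ* ∈ F and for every δ ∈ F one has ⟨w, δ⟩ ≤ ⟨w, δ*⟩; that is, δ* maximizes the linear functional δ ↦ ⟨w, δ⟩ over the intersection of the ℓ_p-ball of radius ε with the box constraint x + δ ∈ [0,1]^d. -/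
/-- The tangent-line inequality for the convex function `s ↦ s ^ p` on the nonnegative reals. -/
lemma rpow_add_mul_sub_le_rpow {p s m : ℝ} (hp : 1 < p) (hs : 0 ≤ s) (hm : 0 ≤ m) :
    m ^ p + p * m ^ (p - 1) * (s - m) ≤ s ^ p := by
  rcases hm.eq_or_lt with rfl | hm
  · rw [Real.zero_rpow (by linarith), Real.zero_rpow (by linarith)]
    simpa using Real.rpow_nonneg hs p
  · have h := one_add_mul_self_le_rpow_one_add (s := s / m - 1) (by
      have := div_nonneg hs hm.le
      linarith) hp.le
    rw [add_sub_cancel, Real.div_rpow hs hm.le, le_div_iff₀ (Real.rpow_pos_of_pos hm p)] at h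
    refine le_trans (le_of_eq ?_) h
    rw [Real.rpow_sub_one hm.ne']
    field_simp

/-- The truncated stationary point maximizes the Lagrangian `t ↦ v * t - μ * |t| ^ p` subject to
`t ≤ g`. -/
lemma mul_sub_mul_rpow_le_min {p μ v g s t : ℝ} (hp : 1 < p) (hμ : 0 < μ) (hv : 0 ≤ v)
    (hg : 0 ≤ g) (hs : 0 ≤ s) (hts : t ≤ s) (htg : t ≤ g) :
    v * t - μ * s ^ p ≤ v * min g ((v / (p * μ)) ^ (1 / (p - 1))) -
      μ * min g ((v / (p * μ)) ^ (1 / (p - 1))) ^ p := by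
  have hpμ : 0 < p * μ := by positivity
  have hq : 0 ≤ v / (p * μ) := by positivity
  have hp1 : 0 < p - 1 := by linarith
  set c := (v / (p * μ)) ^ (1 / (p - 1)) with hc
  have hc0 : 0 ≤ c := Real.rpow_nonneg hq _
  have hcv : p * μ * c ^ (p - 1) = v := by
    rw [hc, ← Real.rpow_mul hq, one_div_mul_cancel hp1.ne', Real.rpow_one]
    field_simp
  have hm : 0 ≤ min g c := le_min hg hc0
  have htan := mul_le_mul_of_nonneg_left (rpow_add_mul_sub_le_rpow hp hs hm) hμ.le
  have hslope : 0 ≤ p * μ * min g c ^ (p - 1) := by positivity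
  have hst := mul_le_mul_of_nonneg_left hts hslope
  have hfactor : (v - p * μ * min g c ^ (p - 1)) * (t - min g c) ≤ 0 := by
    rcases le_total g c with h | h
    · rw [min_eq_left h]
      refine mul_nonpos_of_nonneg_of_nonpos ?_ (by linarith)
      have := mul_le_mul_of_nonneg_left (Real.rpow_le_rpow hg h hp1.le) hpμ.le
      linarith
    · rw [min_eq_right h, hcv, sub_self, zero_mul]
  nlinarith


/-- Proposition 1 (optimality of the explicit solution, non-degenerate case). -/
theorem prop1_nondegenerate
    (d : ℕ) (hd : 1 ≤ d) (p : ℝ) (hp : 1 < p) (ε : ℝ) (hε : 0 < ε)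
    (w x : Fin d → ℝ) (hx : ∀ i, x i ∈ Set.Icc (0 : ℝ) 1)
    (v γ : Fin d → ℝ)
    (hv : ∀ i, v i = |w i|)
    (hγ : ∀ i, γ i = max (-(x i) * Real.sign (w i)) ((1 - x i) * Real.sign (w i)))
    (μ : ℝ) (hμ : 0 < μ)
    (hsum : ∑ i, (min (γ i) ((v i / (p * μ)) ^ (1 / (p - 1)))) ^ p = ε ^ p)
    (δs : Fin d → ℝ)
    (hδs : ∀ i, δs i = min (γ i) ((v i / (p * μ)) ^ (1 / (p - 1))) * Real.sign (w i)) :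
    ((∑ i, |δs i| ^ p) ^ (1 / p) ≤ ε ∧ ∀ i, x i + δs i ∈ Set.Icc (0 : ℝ) 1) ∧
      ∀ δ : Fin d → ℝ,
        (∑ i, |δ i| ^ p) ^ (1 / p) ≤ ε → (∀ i, x i + δ i ∈ Set.Icc (0 : ℝ) 1) →
          ∑ i, w i * δ i ≤ ∑ i, w i * δs i := by
  have hp0 : 0 < p := by linarith
  have hroot : ∀ z : Fin d → ℝ, (∑ i, |z i| ^ p) ^ (1 / p) ≤ ε ↔ ∑ i, |z i| ^ p ≤ ε ^ p := by
    intro z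
    rw [one_div, Real.rpow_inv_le_iff_of_pos
      (Finset.sum_nonneg fun i _ => Real.rpow_nonneg (abs_nonneg _) _) hε.le hp0]
  have hv0 : ∀ i, 0 ≤ v i := fun i => hv i ▸ abs_nonneg _
  have hw : ∀ i, w i = v i * Real.sign (w i) := fun i => by
    rcases lt_trichotomy (w i) 0 with h | h | h
    · simp [hv, Real.sign_of_neg h, abs_of_neg h]
    · simp [h]
    · simp [hv, Real.sign_of_pos h, abs_of_pos h]
  have hγ0 : ∀ i, 0 ≤ γ i := fun i => by
    obtain ⟨h0, h1⟩ := hx i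
    rcases lt_trichotomy (w i) 0 with h | h | h
    · rw [hγ, Real.sign_of_neg h]; exact le_max_of_le_left (by linarith)
    · simp [hγ, h]
    · rw [hγ, Real.sign_of_pos h]; exact le_max_of_le_right (by linarith)
  set m : Fin d → ℝ := fun i => min (γ i) ((v i / (p * μ)) ^ (1 / (p - 1))) with hm
  have hm0 : ∀ i, 0 ≤ m i := fun i =>
    le_min (hγ0 i) (Real.rpow_nonneg (div_nonneg (hv0 i) (by positivity)) _)
  have hmγ : ∀ i, m i ≤ γ i := fun i => min_le_left _ _
  have hδm : ∀ i, δs i = m i * Real.sign (w i) := hδs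
  have hsum' : ∑ i, m i ^ p = ε ^ p := hsum
  have habs : ∀ i, |δs i| ≤ m i := fun i => by
    rw [hδm, abs_mul, abs_of_nonneg (hm0 i)]
    refine mul_le_of_le_one_right (hm0 i) ?_
    rcases Real.sign_apply_eq (w i) with h | h | h <;> simp [h]
  refine ⟨⟨?_, fun i => ?_⟩, fun δ hδ hbox => ?_⟩
  · rw [hroot, ← hsum']
    exact Finset.sum_le_sum fun i _ => Real.rpow_le_rpow (abs_nonneg _) (habs i) hp0.le
  · obtain ⟨h0, h1⟩ := hx i
    have hle := hmγ i
    have hnn := hm0 i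
    rw [hδm]
    rcases lt_trichotomy (w i) 0 with h | h | h
    · rw [hγ, Real.sign_of_neg h, max_eq_left (by linarith)] at hle
      rw [Real.sign_of_neg h]
      constructor <;> linarith
    · simpa [h] using hx i
    · rw [hγ, Real.sign_of_pos h, max_eq_right (by linarith)] at hle
      rw [Real.sign_of_pos h]
      constructor <;> linarith
  · rw [hroot, ← hsum'] at hδ
    have hlag : ∀ i, w i * δ i - μ * |δ i| ^ p ≤ w i * δs i - μ * m i ^ p := fun i => by
      obtain ⟨h0, h1⟩ := hbox i
      have hts : δ i * Real.sign (w i) ≤ |δ i| := by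
        rcases Real.sign_apply_eq (w i) with h | h | h <;>
          simp [h, le_abs_self, neg_le_abs]
      have htγ : δ i * Real.sign (w i) ≤ γ i := by
        rcases lt_trichotomy (w i) 0 with h | h | h
        · rw [hγ, Real.sign_of_neg h]; exact le_max_of_le_left (by linarith)
        · simp [hγ, h]
        · rw [hγ, Real.sign_of_pos h]; exact le_max_of_le_right (by linarith)
      have key : v i * (δ i * Real.sign (w i)) - μ * |δ i| ^ p ≤ v i * m i - μ * m i ^ p :=
        mul_sub_mul_rpow_le_min hp hμ (hv0 i) (hγ0 i) (abs_nonneg (δ i)) hts htγ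
      have hleft : w i * δ i = v i * (δ i * Real.sign (w i)) := by
        linear_combination δ i * hw i
      have hright : w i * δs i = v i * m i := by
        rw [hδm, hv]
        rcases lt_trichotomy (w i) 0 with h | h | h
        · rw [Real.sign_of_neg h, abs_of_neg h]; ring
        · simp [h]
        · rw [Real.sign_of_pos h, abs_of_pos h]; ring
      rw [hleft, hright]
      exact key
    have htotal := Finset.sum_le_sum fun i (_ : i ∈ Finset.univ) => hlag i
    simp only [Finset.sum_sub_distrib, ← Finset.mul_sum] at htotal
    have := mul_le_mul_of_nonneg_left hδ hμ.le
    linarith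
end

section
/- Reduction to the sign-aligned problem (forward direction): For every δ ∈ F, the vector η defined by η_i = max(δ_i · sign(w_i), 0) satisfies 0 ≤ η_i ≤ γ_i for all i, Σ_{i=1}^d η_i^p ≤ ε^p, and ⟨w, δ⟩ ≤ Σ_{i=1}^d v_i · η_i. -/
/-- Reduction to the sign-aligned problem (forward direction). -/
theorem reduction_forward
    (d : ℕ) (hd : 1 ≤ d) (p : ℝ) (hp : 1 < p) (ε : ℝ) (hε : 0 < ε)
    (w x : Fin d → ℝ) (hx : ∀ i, x i ∈ Set.Icc (0 : ℝ) 1)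
    (v γ : Fin d → ℝ)
    (hv : ∀ i, v i = |w i|)
    (hγ : ∀ i, γ i = max (-(x i) * Real.sign (w i)) ((1 - x i) * Real.sign (w i)))
    (δ : Fin d → ℝ)
    (hδnorm : (∑ i, |δ i| ^ p) ^ (1 / p) ≤ ε)
    (hδbox : ∀ i, x i + δ i ∈ Set.Icc (0 : ℝ) 1)
    (η : Fin d → ℝ)
    (hη : ∀ i, η i = max (δ i * Real.sign (w i)) 0) :
    (∀ i, 0 ≤ η i ∧ η i ≤ γ i) ∧
      ∑ i, (η i) ^ p ≤ ε ^ p ∧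
      ∑ i, w i * δ i ≤ ∑ i, v i * η i := by
  have hp0 : 0 < p := by linarith
  have hη0 (i : Fin d) : 0 ≤ η i := (hη i).symm ▸ le_max_right _ _
  refine ⟨fun i => ⟨hη0 i, ?_⟩, ?_, ?_⟩
  · obtain ⟨hx0, hx1⟩ := hx i
    obtain ⟨hb0, hb1⟩ := hδbox i
    rw [hη, hγ]
    rcases lt_trichotomy (w i) 0 with h | h | h
    · rw [Real.sign_of_neg h]
      exact max_le (le_max_of_le_left (by linarith)) (le_max_of_le_left (by linarith))
    · simp [h]
    · rw [Real.sign_of_pos h]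
      exact max_le (le_max_of_le_right (by linarith)) (le_max_of_le_right (by linarith))
  · have hle (i : Fin d) : η i ≤ |δ i| := by
      rw [hη]
      refine max_le ?_ (abs_nonneg _)
      rcases Real.sign_apply_eq (w i) with h | h | h <;> rw [h]
      · simpa using neg_le_abs (δ i)
      · simp
      · simpa using le_abs_self (δ i)
    have hS : 0 ≤ ∑ i, |δ i| ^ p := Finset.sum_nonneg fun i _ => by positivity
    calc ∑ i, η i ^ p ≤ ∑ i, |δ i| ^ p :=
          Finset.sum_le_sum fun i _ => Real.rpow_le_rpow (hη0 i) (hle i) hp0.le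
      _ = ((∑ i, |δ i| ^ p) ^ (1 / p)) ^ p := by
          rw [one_div, Real.rpow_inv_rpow hS hp0.ne']
      _ ≤ ε ^ p := Real.rpow_le_rpow (Real.rpow_nonneg hS _) hδnorm hp0.le
  · refine Finset.sum_le_sum fun i _ => ?_
    have hw : w i * δ i = |w i| * (δ i * Real.sign (w i)) := by
      rcases lt_trichotomy (w i) 0 with h | h | h
      · rw [Real.sign_of_neg h, abs_of_neg h]; ring
      · simp [h]
      · rw [Real.sign_of_pos h, abs_of_pos h]; ring
    rw [hw, hv, hη]
    exact mul_le_mul_of_nonneg_left (le_max_left _ _) (abs_nonneg _)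
end

section
/- Equality of optimal values for the original and reduced problems: the supremum of ⟨w, δ⟩ over δ ∈ F equals the supremum of Σ_{i=1}^d v_i · η_i over η ∈ G, and both suprema are attained. -/
theorem abs_sign_mul_eq_self_of_le_max {w x t : ℝ} (ht : 0 ≤ t)
    (htγ : t ≤ max (-x * Real.sign w) ((1 - x) * Real.sign w)) : |Real.sign w * t| = t := by
  rcases lt_trichotomy w 0 with hw | rfl | hw
  · simp [Real.sign_of_neg hw, abs_of_nonneg ht]
  · simp only [Real.sign_zero, mul_zero, max_self] at htγ
    simp [le_antisymm htγ ht]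
  · simp [Real.sign_of_pos hw, abs_of_nonneg ht]

theorem add_sign_mul_mem_Icc {w x t : ℝ} (hx : x ∈ Set.Icc (0 : ℝ) 1) (ht : 0 ≤ t)
    (htγ : t ≤ max (-x * Real.sign w) ((1 - x) * Real.sign w)) :
    x + Real.sign w * t ∈ Set.Icc (0 : ℝ) 1 := by
  obtain ⟨h0, h1⟩ := hx
  rcases lt_trichotomy w 0 with hw | rfl | hw
  · rw [Real.sign_of_neg hw] at htγ ⊢
    rcases le_max_iff.1 htγ with h | h <;> constructor <;> linarith
  · simpa using ⟨h0, h1⟩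
  · rw [Real.sign_of_pos hw] at htγ ⊢
    rcases le_max_iff.1 htγ with h | h <;> constructor <;> linarith

theorem mul_sign_mul_eq_abs_mul (w t : ℝ) : w * (Real.sign w * t) = |w| * t := by
  rcases lt_trichotomy w 0 with hw | rfl | hw
  · simp [Real.sign_of_neg hw, abs_of_neg hw]
  · simp
  · simp [Real.sign_of_pos hw, abs_of_pos hw]

theorem max_zero_sign_mul_le {w x s : ℝ} (hx : x ∈ Set.Icc (0 : ℝ) 1)
    (hs : x + s ∈ Set.Icc (0 : ℝ) 1) :
    max 0 (Real.sign w * s) ≤ max (-x * Real.sign w) ((1 - x) * Real.sign w) := by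
  obtain ⟨h0, h1⟩ := hx
  obtain ⟨h2, h3⟩ := hs
  rcases lt_trichotomy w 0 with hw | rfl | hw
  · rw [Real.sign_of_neg hw]
    exact le_max_of_le_left (max_le (by linarith) (by linarith))
  · simp
  · rw [Real.sign_of_pos hw]
    exact le_max_of_le_right (max_le (by linarith) (by linarith))

theorem max_zero_sign_mul_le_abs (w s : ℝ) : max 0 (Real.sign w * s) ≤ |s| := by
  refine max_le (abs_nonneg s) ?_
  rcases Real.sign_apply_eq w with h | h | h <;> rw [h]
  · simpa using neg_le_abs s
  · simp
  · simpa using le_abs_self s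

theorem mul_le_abs_mul_max_zero_sign_mul (w s : ℝ) :
    w * s ≤ |w| * max 0 (Real.sign w * s) := by
  refine le_trans (le_of_eq ?_) (mul_le_mul_of_nonneg_left (le_max_right _ _) (abs_nonneg w))
  rcases lt_trichotomy w 0 with hw | rfl | hw
  · simp [Real.sign_of_neg hw, abs_of_neg hw]
  · simp
  · simp [Real.sign_of_pos hw, abs_of_pos hw]

theorem isCompact_box_inter_rpow_ball {ι : Type*} [Fintype ι] {p : ℝ} (hp : 0 ≤ p) (γ : ι → ℝ)
    (r : ℝ) :
    IsCompact {η : ι → ℝ | (∀ i, 0 ≤ η i ∧ η i ≤ γ i) ∧ ∑ i, (η i) ^ p ≤ r} := by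
  have hclosed : IsClosed {η : ι → ℝ | ∑ i, (η i) ^ p ≤ r} :=
    isClosed_le (continuous_finsetSum _ fun i _ =>
      (Real.continuous_rpow_const hp).comp (continuous_apply i)) continuous_const
  convert (isCompact_Icc (a := (0 : ι → ℝ)) (b := γ)).inter_right hclosed using 1
  ext η
  simp [Pi.le_def, forall_and]


/-- Equality of optimal values for the original and reduced problems, with attainment. -/
theorem optimal_values_eq
    (d : ℕ) (hd : 1 ≤ d) (p : ℝ) (hp : 1 < p) (ε : ℝ) (hε : 0 < ε)
    (w x : Fin d → ℝ) (hx : ∀ i, x i ∈ Set.Icc (0 : ℝ) 1)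
    (v γ : Fin d → ℝ)
    (hv : ∀ i, v i = |w i|)
    (hγ : ∀ i, γ i = max (-(x i) * Real.sign (w i)) ((1 - x i) * Real.sign (w i))) :
    ∃ M : ℝ,
      IsGreatest ((fun δ : Fin d → ℝ => ∑ i, w i * δ i) ''
        {δ : Fin d → ℝ | (∑ i, |δ i| ^ p) ^ (1 / p) ≤ ε ∧
          ∀ i, x i + δ i ∈ Set.Icc (0 : ℝ) 1}) M ∧
      IsGreatest ((fun η : Fin d → ℝ => ∑ i, v i * η i) ''
        {η : Fin d → ℝ | (∀ i, 0 ≤ η i ∧ η i ≤ γ i) ∧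
          ∑ i, (η i) ^ p ≤ ε ^ p}) M := by
  have hp0 : 0 < p := one_pos.trans hp
  obtain rfl : v = fun i => |w i| := funext hv
  obtain ⟨η, ⟨hη, hηp⟩, hmax⟩ :=
    (isCompact_box_inter_rpow_ball hp0.le γ (ε ^ p)).exists_isMaxOn
      ⟨0, fun i => ⟨le_rfl, by
        simpa [hγ] using (le_max_left _ _).trans
          (max_zero_sign_mul_le (w := w i) (s := 0) (hx i) (by simpa using hx i))⟩,
        by simpa [Real.zero_rpow hp0.ne'] using (Real.rpow_pos_of_pos hε p).le⟩
      (f := fun η : Fin d → ℝ => ∑ i, |w i| * η i) (by fun_prop)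
  have hball (δ : Fin d → ℝ) : (∑ i, |δ i| ^ p) ^ (1 / p) ≤ ε ↔ ∑ i, |δ i| ^ p ≤ ε ^ p := by
    rw [one_div, Real.rpow_inv_le_iff_of_pos
      (Finset.sum_nonneg fun i _ => Real.rpow_nonneg (abs_nonneg _) _) hε.le hp0]
  have hηγ (i : Fin d) := (hη i).2.trans_eq (hγ i)
  refine ⟨∑ i, |w i| * η i, ⟨⟨fun i => Real.sign (w i) * η i, ⟨?_, fun i => ?_⟩, ?_⟩, ?_⟩,
    ⟨⟨η, ⟨hη, hηp⟩, rfl⟩, ?_⟩⟩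
  · rw [hball]
    simpa only [abs_sign_mul_eq_self_of_le_max (hη _).1 (hηγ _)] using hηp
  · exact add_sign_mul_mem_Icc (hx i) (hη i).1 (hηγ i)
  · simp only [mul_sign_mul_eq_abs_mul]
  · rintro _ ⟨δ, ⟨hδ, hδx⟩, rfl⟩
    rw [hball] at hδ
    refine (Finset.sum_le_sum fun i _ => mul_le_abs_mul_max_zero_sign_mul (w i) (δ i)).trans
      (hmax (a := fun i => max 0 (Real.sign (w i) * δ i)) ⟨fun i => ⟨le_max_left _ _, ?_⟩, ?_⟩)
    · rw [hγ]
      exact max_zero_sign_mul_le (hx i) (hδx i)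
    · exact (Finset.sum_le_sum fun i _ => Real.rpow_le_rpow (le_max_left _ _)
        (max_zero_sign_mul_le_abs (w i) (δ i)) hp0.le).trans hδ
  · rintro _ ⟨ζ, hζ, rfl⟩
    exact hmax hζ
end

section
/- Existence of the multiplier μ*: if Σ_{i : w_i ≠ 0} γ_i^p ≥ ε^p, then there exists μ* > 0 such that Σ_{i=1}^d (min{γ_i, (v_i/(p·μ*))^{1/(p−1)}})^p = ε^p. -/
/-- Existence of the multiplier μ*. -/
theorem multiplier_exists
    (d : ℕ) (hd : 1 ≤ d) (p : ℝ) (hp : 1 < p) (ε : ℝ) (hε : 0 < ε)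
    (w x : Fin d → ℝ) (hx : ∀ i, x i ∈ Set.Icc (0 : ℝ) 1)
    (v γ : Fin d → ℝ)
    (hv : ∀ i, v i = |w i|)
    (hγ : ∀ i, γ i = max (-(x i) * Real.sign (w i)) ((1 - x i) * Real.sign (w i)))
    (hge : ε ^ p ≤ ∑ i ∈ Finset.univ.filter (fun i => w i ≠ 0), (γ i) ^ p) :
    ∃ μ : ℝ, 0 < μ ∧
      ∑ i, (min (γ i) ((v i / (p * μ)) ^ (1 / (p - 1)))) ^ p = ε ^ p := by
  have hγ01 : ∀ i, 0 ≤ γ i ∧ γ i ≤ 1 := by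
    intro i
    obtain ⟨h0, h1⟩ := hx i
    rw [hγ i]
    rcases lt_trichotomy (w i) 0 with h | h | h
    · rw [Real.sign_of_neg h, max_eq_left (by linarith)]
      constructor <;> linarith
    · simp [h]
    · rw [Real.sign_of_pos h, max_eq_right (by linarith)]
      constructor <;> linarith
  have hp0 : 0 < p := by linarith
  have hq : 0 < 1 / (p - 1) := one_div_pos.mpr (by linarith)
  have hεp : 0 < ε ^ p := Real.rpow_pos_of_pos hε p
  -- Reparametrise by `t = 1 / (p * μ)`, so that the sum is continuous on all of `ℝ`.
  let G : ℝ → ℝ := fun t => ∑ i, (min (γ i) ((v i * t) ^ (1 / (p - 1)))) ^ p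
  have hG : Continuous G := by
    refine continuous_finsetSum _ fun i _ => ?_
    exact (continuous_const.min ((continuous_const.mul continuous_id).rpow_const
      fun _ => Or.inr hq.le)).rpow_const fun _ => Or.inr hp0.le
  have hG0 : G 0 = 0 := by
    refine Finset.sum_eq_zero fun i _ => ?_
    rw [mul_zero, Real.zero_rpow hq.ne', min_eq_right (hγ01 i).1, Real.zero_rpow hp0.ne']
  set T : ℝ := ∑ i, |w i|⁻¹ with hT
  have hT0 : 0 ≤ T := Finset.sum_nonneg fun i _ => by positivity
  have hGT : ε ^ p ≤ G T := by
    refine hge.trans ?_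
    calc ∑ i ∈ Finset.univ.filter (fun i => w i ≠ 0), (γ i) ^ p
        = ∑ i ∈ Finset.univ.filter (fun i => w i ≠ 0),
            (min (γ i) ((v i * T) ^ (1 / (p - 1)))) ^ p := by
          refine Finset.sum_congr rfl fun i hi => ?_
          have hwi : 0 < |w i| := abs_pos.mpr (Finset.mem_filter.mp hi).2
          have hle : |w i|⁻¹ ≤ T :=
            Finset.single_le_sum (f := fun j => |w j|⁻¹) (fun j _ => by positivity)
              (Finset.mem_univ i)
          have hvT : 1 ≤ v i * T := by
            rw [hv i, ← mul_inv_cancel₀ hwi.ne']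
            exact mul_le_mul_of_nonneg_left hle hwi.le
          rw [min_eq_left ((hγ01 i).2.trans (Real.one_le_rpow hvT hq.le))]
      _ ≤ G T := by
          refine Finset.sum_le_sum_of_subset_of_nonneg (Finset.filter_subset _ _) fun i _ _ => ?_
          have hvi : 0 ≤ v i := hv i ▸ abs_nonneg _
          exact Real.rpow_nonneg (le_min (hγ01 i).1
            (Real.rpow_nonneg (mul_nonneg hvi hT0) _)) _
  obtain ⟨t, ht, hGt⟩ := intermediate_value_Icc hT0 hG.continuousOn ⟨hG0.le.trans hεp.le, hGT⟩
  have ht0 : 0 < t := by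
    refine lt_of_le_of_ne ht.1 fun h => ?_
    rw [← h, hG0] at hGt
    exact hεp.ne hGt
  refine ⟨1 / (p * t), by positivity, ?_⟩
  rw [← hGt]
  refine Finset.sum_congr rfl fun i _ => ?_
  have hdiv : v i / (p * (1 / (p * t))) = v i * t := by field_simp
  rw [hdiv]
end

section
/- Optimality in the reduced problem: suppose μ* > 0 and the vector η* defined by η*_i = min{γ_i, (v_i/(p·μ*))^{1/(p−1)}} satisfies Σ_{i=1}^d (η*_i)^p = ε^p. Then η* ∈ G and for every η ∈ G one has Σ_{i=1}^d v_i · η_i ≤ Σ_{i=1}^d v_i · η*_i. -/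
/-- The tangent line inequality for the convex function `t ↦ t ^ p` on the nonnegative reals. -/
theorem rpow_add_mul_sub_le_rpow_s12 {p a b : ℝ} (hp : 1 < p) (ha : 0 ≤ a) (hb : 0 ≤ b) :
    b ^ p + p * b ^ (p - 1) * (a - b) ≤ a ^ p := by
  rcases hb.eq_or_lt with rfl | hb
  · rw [Real.zero_rpow (by linarith), Real.zero_rpow (by linarith)]
    simpa using Real.rpow_nonneg ha p
  · have hs : -1 ≤ a / b - 1 := by linarith [div_nonneg ha hb.le]
    have h := one_add_mul_self_le_rpow_one_add hs hp.le
    rw [add_sub_cancel, Real.div_rpow ha hb.le, le_div_iff₀ (Real.rpow_pos_of_pos hb p)] at h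
    have hbp : b ^ p = b ^ (p - 1) * b := by
      rw [← Real.rpow_add_one hb.ne', sub_add_cancel]
    calc b ^ p + p * b ^ (p - 1) * (a - b) = (1 + p * (a / b - 1)) * b ^ p := by
          rw [hbp]; field_simp
      _ ≤ a ^ p := h

/-- The truncated stationary point maximizes the one-variable Lagrangian
`t ↦ v * t - μ * t ^ p` on the interval `[0, γ]`. -/
theorem mul_sub_mul_rpow_le_of_eq_min {p μ v γ a b : ℝ} (hp : 1 < p) (hμ : 0 < μ)
    (hv : 0 ≤ v) (ha : 0 ≤ a) (haγ : a ≤ γ)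
    (hb : b = min γ ((v / (p * μ)) ^ (1 / (p - 1)))) :
    v * a - μ * a ^ p ≤ v * b - μ * b ^ p := by
  have hpμ : 0 < p * μ := by positivity
  have hq : 0 ≤ v / (p * μ) := by positivity
  have ht : ((v / (p * μ)) ^ (1 / (p - 1))) ^ (p - 1) = v / (p * μ) := by
    rw [one_div, Real.rpow_inv_rpow hq (by linarith)]
  have ht0 : 0 ≤ (v / (p * μ)) ^ (1 / (p - 1)) := Real.rpow_nonneg hq _
  have hb0 : 0 ≤ b := hb ▸ le_min (ha.trans haγ) ht0
  have htan := mul_le_mul_of_nonneg_left (rpow_add_mul_sub_le_rpow_s12 hp ha hb0) hμ.le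
  have hslope : (v - p * μ * b ^ (p - 1)) * (a - b) ≤ 0 := by
    rcases le_total γ ((v / (p * μ)) ^ (1 / (p - 1))) with h | h
    · rw [min_eq_left h] at hb
      have hle : b ^ (p - 1) ≤ v / (p * μ) :=
        ht ▸ Real.rpow_le_rpow hb0 (hb ▸ h) (by linarith)
      rw [le_div_iff₀ hpμ] at hle
      exact mul_nonpos_of_nonneg_of_nonpos (by linarith) (by linarith)
    · rw [min_eq_right h] at hb
      rw [hb, ht, mul_div_cancel₀ _ hpμ.ne', sub_self, zero_mul]
  linarith

/-- The upper bound of the reduced box constraint is nonnegative. -/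
theorem max_neg_mul_sign_nonneg {x : ℝ} (w : ℝ) (hx : x ∈ Set.Icc (0 : ℝ) 1) :
    0 ≤ max (-x * Real.sign w) ((1 - x) * Real.sign w) := by
  obtain ⟨h0, h1⟩ := hx
  rcases Real.sign_apply_eq w with h | h | h <;> rw [h]
  · exact le_max_of_le_left (by linarith)
  · simp
  · exact le_max_of_le_right (by linarith)

/-- Optimality in the reduced problem. -/
theorem reduced_problem_optimality
    (d : ℕ) (hd : 1 ≤ d) (p : ℝ) (hp : 1 < p) (ε : ℝ) (hε : 0 < ε)
    (w x : Fin d → ℝ) (hx : ∀ i, x i ∈ Set.Icc (0 : ℝ) 1)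
    (v γ : Fin d → ℝ)
    (hv : ∀ i, v i = |w i|)
    (hγ : ∀ i, γ i = max (-(x i) * Real.sign (w i)) ((1 - x i) * Real.sign (w i)))
    (μ : ℝ) (hμ : 0 < μ)
    (ηs : Fin d → ℝ)
    (hηs : ∀ i, ηs i = min (γ i) ((v i / (p * μ)) ^ (1 / (p - 1))))
    (hsum : ∑ i, (ηs i) ^ p = ε ^ p) :
    ((∀ i, 0 ≤ ηs i ∧ ηs i ≤ γ i) ∧ ∑ i, (ηs i) ^ p ≤ ε ^ p) ∧
      ∀ η : Fin d → ℝ, (∀ i, 0 ≤ η i ∧ η i ≤ γ i) → ∑ i, (η i) ^ p ≤ ε ^ p →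
        ∑ i, v i * η i ≤ ∑ i, v i * ηs i := by
  have hv0 : ∀ i, 0 ≤ v i := fun i => hv i ▸ abs_nonneg _
  have hγ0 : ∀ i, 0 ≤ γ i := fun i => hγ i ▸ max_neg_mul_sign_nonneg (w i) (hx i)
  refine ⟨⟨fun i => ⟨?_, hηs i ▸ min_le_left _ _⟩, hsum.le⟩, fun η hη hηsum => ?_⟩
  · rw [hηs i]
    exact le_min (hγ0 i) (Real.rpow_nonneg (div_nonneg (hv0 i) (by positivity)) _)
  · have h := Finset.sum_le_sum fun i (_ : i ∈ Finset.univ) =>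
      mul_sub_mul_rpow_le_of_eq_min hp hμ (hv0 i) (hη i).1 (hη i).2 (hηs i)
    simp only [Finset.sum_sub_distrib, ← Finset.mul_sum, hsum] at h
    linarith [mul_le_mul_of_nonneg_left hηsum hμ.le]
end

section
/- Strict positivity of maximizer coordinates (impossibility of the KKT case η_i = 0 with v_i > 0): let ε > 0 and let η* maximize Σ_{i=1}^d v_i · η_i over G. Then for every index i with v_i > 0 and γ_i > 0, one has η*_i > 0. -/
/-- For `1 < p`, a small positive `u` satisfies any prescribed bounds on `u`,
`u * ε` and `u ^ (p - 1) * V`. -/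
theorem exists_small_rpow_sub_one_mul_lt {p : ℝ} (hp : 1 < p) (ε V : ℝ) {g a : ℝ}
    (hg : 0 < g) (ha : 0 < a) :
    ∃ u : ℝ, 0 < u ∧ u < 1 ∧ u * ε < g ∧ u ^ (p - 1) * V < a := by
  have hpow : ContinuousAt (fun u : ℝ => u ^ (p - 1) * V) 0 :=
    (Real.continuousAt_rpow_const 0 (p - 1) (Or.inr (by linarith))).mul continuousAt_const
  have hmul : ContinuousAt (fun u : ℝ => u * ε) 0 := by fun_prop
  have h₁ : ∀ᶠ u : ℝ in nhds 0, u ^ (p - 1) * V < a :=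
    hpow.eventually_lt_const (by simpa [Real.zero_rpow (by linarith : p - 1 ≠ 0)] using ha)
  have h₂ : ∀ᶠ u : ℝ in nhds 0, u * ε < g := hmul.eventually_lt_const (by simpa using hg)
  have h₃ : ∀ᶠ u : ℝ in nhds 0, u < 1 := eventually_lt_nhds one_pos
  obtain ⟨u, hu, hu₁, hu₂, hu₃⟩ := (eventually_mem_nhdsWithin.and
    ((h₃.and (h₂.and h₁)).filter_mono nhdsWithin_le_nhds) :
      ∀ᶠ u : ℝ in nhdsWithin 0 (Set.Ioi 0), _).exists
  exact ⟨u, hu, hu₁, hu₂, hu₃⟩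

/-- Strict positivity of maximizer coordinates:
the KKT case η_i = 0 with v_i > 0 is impossible. -/
theorem maximizer_coords_pos
    (d : ℕ) (hd : 1 ≤ d) (p : ℝ) (hp : 1 < p) (ε : ℝ) (hε : 0 < ε)
    (w x : Fin d → ℝ) (hx : ∀ i, x i ∈ Set.Icc (0 : ℝ) 1)
    (v γ : Fin d → ℝ)
    (hv : ∀ i, v i = |w i|)
    (hγ : ∀ i, γ i = max (-(x i) * Real.sign (w i)) ((1 - x i) * Real.sign (w i)))
    (ηs : Fin d → ℝ)
    (hmem : (∀ i, 0 ≤ ηs i ∧ ηs i ≤ γ i) ∧ ∑ i, (ηs i) ^ p ≤ ε ^ p)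
    (hmax : ∀ η : Fin d → ℝ, (∀ i, 0 ≤ η i ∧ η i ≤ γ i) → ∑ i, (η i) ^ p ≤ ε ^ p →
      ∑ i, v i * η i ≤ ∑ i, v i * ηs i) :
    ∀ i, 0 < v i → 0 < γ i → 0 < ηs i := by
  intro i hvi hγi
  obtain ⟨hbox, hball⟩ := hmem
  refine (hbox i).1.lt_of_ne' fun hi => ?_
  obtain ⟨u, hu, hu1, hug, huV⟩ := exists_small_rpow_sub_one_mul_lt hp ε (∑ j, v j * ηs j)
    hγi (mul_pos hvi hε)
  have hup : u ^ p = u * u ^ (p - 1) := by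
    rw [← Real.rpow_one_add' hu.le (by linarith)]
    congr 1
    ring
  have ht0 : 0 < u ^ p := Real.rpow_pos_of_pos hu p
  have ht1 : u ^ p < 1 := Real.rpow_lt_one hu.le hu1 (by linarith)
  -- Shrink `ηs` by the factor `1 - u ^ p` and spend the freed budget on coordinate `i`.
  have key := hmax (fun j => (1 - u ^ p) * ηs j + if j = i then u * ε else 0) ?_ ?_
  · simp only [mul_add, Finset.sum_add_distrib, mul_left_comm _ (1 - u ^ p),
      ← Finset.mul_sum, mul_ite, mul_zero, Finset.sum_ite_eq', Finset.mem_univ, if_true] at key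
    have hgain := mul_lt_mul_of_pos_left huV hu
    rw [hup] at key
    linarith
  · intro j
    obtain ⟨hj0, hj1⟩ := hbox j
    by_cases hj : j = i
    · subst hj
      simp only [hi, mul_zero, if_true, zero_add]
      exact ⟨by positivity, hug.le⟩
    · simp only [hj, if_false, add_zero]
      exact ⟨mul_nonneg (by linarith) hj0, by nlinarith⟩
  · have hterm : ∀ j, ((1 - u ^ p) * ηs j + if j = i then u * ε else 0) ^ p
        = (1 - u ^ p) ^ p * ηs j ^ p + if j = i then u ^ p * ε ^ p else 0 := by
      intro j
      by_cases hj : j = i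
      · subst hj
        simp [hi, Real.zero_rpow (by linarith : p ≠ 0), Real.mul_rpow hu.le hε.le]
      · simp [hj, Real.mul_rpow (by linarith : 0 ≤ 1 - u ^ p) (hbox j).1]
    simp only [hterm, Finset.sum_add_distrib, ← Finset.mul_sum, Finset.sum_ite_eq',
      Finset.mem_univ, if_true]
    have hshrink : (1 - u ^ p) ^ p ≤ 1 - u ^ p :=
      Real.rpow_le_self_of_le_one (by linarith) (by linarith) hp.le
    calc (1 - u ^ p) ^ p * ∑ j, ηs j ^ p + u ^ p * ε ^ p
        ≤ (1 - u ^ p) * ε ^ p + u ^ p * ε ^ p := by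
          gcongr
          exact Finset.sum_nonneg fun j _ => Real.rpow_nonneg (hbox j).1 p
      _ = ε ^ p := by ring
end
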